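/- Let G be a finite simple graph on vertex set {x_{11}, …, x_{n1}} with no isolated vertex. Let C_1, …, C_m (0 ≤ m ≤ n) be cycle graphs with x_{i1} ∈ V(C_i), and let G_{m+1}, …, G_n be connected chordal graphs with at least two vertices such that x_{i1} is a neighbor of a simplicial vertex of G_i for each i = m+1, …, n. Set G' = G(C_1, …, C_m, G_{m+1}, …, G_n). Then G' is shellable if and only if every cycle C_i (1 ≤ i ≤ m) has length 3 or 5. -/

import Mathlib

variable {V : Type*} [DecidableEq V]

/-- `S` is an independent set of the induced subgraph of `G` on the vertex set `A`. -/
def IsIndepIn (G : SimpleGraph V) (A S : Finset V) : Prop :=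
  S ⊆ A ∧ ∀ u ∈ S, ∀ v ∈ S, ¬G.Adj u v

/-- `S` is a maximal independent set of the induced subgraph of `G` on the vertex set `A`. -/
def IsMaxIndepIn (G : SimpleGraph V) (A S : Finset V) : Prop :=
  IsIndepIn G A S ∧ ∀ T, IsIndepIn G A T → S ⊆ T → S = T

/-- The induced subgraph of `G` on `A` is unmixed: all maximal independent sets
have the same cardinality. -/
def UnmixedOn (G : SimpleGraph V) (A : Finset V) : Prop :=
  ∀ S T, IsMaxIndepIn G A S → IsMaxIndepIn G A T → S.card = T.card

open scoped Classical in
/-- The vertex set `A \ N_G[x]`. -/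
noncomputable def delClosedNbhd (G : SimpleGraph V) (A : Finset V) (x : V) : Finset V :=
  A.filter fun y => y ≠ x ∧ ¬G.Adj x y

/-- The induced subgraph of `G` on `A` is vertex decomposable. -/
inductive VertexDecomposableOn (G : SimpleGraph V) : Finset V → Prop
  | edgeless (A : Finset V) (h : ∀ u ∈ A, ∀ v ∈ A, ¬G.Adj u v) : VertexDecomposableOn G A
  | shed (A : Finset V) (x : V) (hx : x ∈ A)
      (hlink : VertexDecomposableOn G (delClosedNbhd G A x))
      (hdel : VertexDecomposableOn G (A.erase x))
      (hexch : ∀ S, IsIndepIn G (delClosedNbhd G A x) S →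
        ∃ y ∈ A, G.Adj x y ∧ IsIndepIn G (A.erase x) (insert y S)) :
      VertexDecomposableOn G A

/-- `x` is a shedding vertex of the induced subgraph of `G` on `A`. -/
def IsSheddingVertexOn (G : SimpleGraph V) (A : Finset V) (x : V) : Prop :=
  x ∈ A ∧
  VertexDecomposableOn G (delClosedNbhd G A x) ∧
  VertexDecomposableOn G (A.erase x) ∧
  ∀ S, IsIndepIn G (delClosedNbhd G A x) S →
    ∃ y ∈ A, G.Adj x y ∧ IsIndepIn G (A.erase x) (insert y S)

/-- The independence complex of the induced subgraph of `G` on `A` is shellable: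
there is an ordering `F 0, F 1, …` of its facets (the maximal independent sets) such
that for every `i`, every face of the subcomplex `(⋃ j < i, ⟨F j⟩) ∩ ⟨F i⟩` is contained
in a face of that subcomplex of cardinality `(F i).card - 1` (i.e. the subcomplex is
pure of dimension `dim (F i) - 1`). -/
def ShellableOn (G : SimpleGraph V) (A : Finset V) : Prop :=
  ∃ (t : ℕ) (F : Fin t → Finset V),
    Function.Injective F ∧
    (∀ S, IsMaxIndepIn G A S ↔ ∃ i, F i = S) ∧
    ∀ i : Fin t, ∀ S : Finset V, S ⊆ F i → (∃ j, j < i ∧ S ⊆ F j) →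
      ∃ S' : Finset V, S ⊆ S' ∧ S' ⊆ F i ∧ (∃ j, j < i ∧ S' ⊆ F j) ∧
        S'.card = (F i).card - 1

/-- A graph is chordal if every cycle of length at least four has a chord, i.e. an
edge of the graph joining two vertices of the cycle that is not an edge of the cycle. -/
def IsChordal (G : SimpleGraph V) : Prop :=
  ∀ (x : V) (w : G.Walk x x), w.IsCycle → 4 ≤ w.length →
    ∃ u v, u ∈ w.support ∧ v ∈ w.support ∧ G.Adj u v ∧ s(u, v) ∉ w.edges

/-- The induced subgraph of `G` on `A` is a cycle graph on `m` vertices. -/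
def IsCycleGraphOn (G : SimpleGraph V) (A : Finset V) (m : ℕ) : Prop :=
  (∀ u v, G.Adj u v → u ∈ A ∧ v ∈ A) ∧
  Nonempty (G.induce (A : Set V) ≃g SimpleGraph.cycleGraph m)

/-- The independence number of the induced subgraph of `G` on `A`. -/
noncomputable def indepNumOn (G : SimpleGraph V) (A : Finset V) : ℕ :=
  sSup {k | ∃ S, IsIndepIn G A S ∧ S.card = k}


/-- Rank-function form of shellability. -/
def ShRank (G : SimpleGraph V) (A : Finset V) : Prop :=
  ∃ r : Finset V → ℕ,
    (∀ F F', IsMaxIndepIn G A F → IsMaxIndepIn G A F' → r F = r F' → F = F') ∧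
    ∀ F F', IsMaxIndepIn G A F → IsMaxIndepIn G A F' → r F' < r F →
      ∃ F'', IsMaxIndepIn G A F'' ∧ r F'' < r F ∧ ∃ p ∈ F, p ∉ F' ∧ F.erase p ⊆ F''

theorem ShellableOn.shRank {G : SimpleGraph V} {A : Finset V} (h : ShellableOn G A) :
    ShRank G A := by
  classical
  obtain ⟨t, F, hinj, hF, hsh⟩ := h
  have hr : ∃ r : Finset V → ℕ, ∀ i, r (F i) = (i : ℕ) := by
    refine ⟨fun S => if h : ∃ i, F i = S then (h.choose : ℕ) else 0, fun i => ?_⟩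
    have h : ∃ j, F j = F i := ⟨i, rfl⟩
    simp only [h, dif_pos]
    have := hinj h.choose_spec
    rw [this]
  obtain ⟨r, hr⟩ := hr
  refine ⟨r, ?_, ?_⟩
  · intro S S' hS hS' h
    obtain ⟨i, rfl⟩ := (hF S).1 hS
    obtain ⟨j, rfl⟩ := (hF S').1 hS'
    rw [hr, hr] at h
    rw [Fin.ext h]
  · intro S S' hS hS' h
    obtain ⟨i, rfl⟩ := (hF S).1 hS
    obtain ⟨j, rfl⟩ := (hF S').1 hS'
    rw [hr, hr] at h
    obtain ⟨T, h1, h2, ⟨k, hk, h3⟩, h4⟩ := hsh i (F i ∩ F j) Finset.inter_subset_left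
      ⟨j, h, Finset.inter_subset_right⟩
    have hpos : 0 < (F i).card := by
      rw [Finset.card_pos, Finset.nonempty_iff_ne_empty]
      intro h0
      have := hS.2 (F j) hS'.1 (by rw [h0]; simp)
      have := hinj this
      rw [this] at h
      exact lt_irrefl _ h
    have hc : (F i \ T).card = 1 := by
      rw [Finset.card_sdiff_of_subset h2]; omega
    obtain ⟨p, hp⟩ := Finset.card_eq_one.1 hc
    have hp1 : p ∈ F i \ T := by rw [hp]; simp
    rw [Finset.mem_sdiff] at hp1
    refine ⟨F k, (hF _).2 ⟨k, rfl⟩, by rw [hr, hr]; exact hk, p, hp1.1, ?_, ?_⟩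
    · intro h5
      exact hp1.2 (h1 (Finset.mem_inter.2 ⟨hp1.1, h5⟩))
    · intro q hq
      rw [Finset.mem_erase] at hq
      apply h3
      by_contra h6
      have : q ∈ F i \ T := Finset.mem_sdiff.2 ⟨hq.2, h6⟩
      rw [hp] at this
      exact hq.1 (Finset.mem_singleton.1 this)

theorem ShRank.shellableOn {G : SimpleGraph V} {A : Finset V} (h : ShRank G A) :
    ShellableOn G A := by
  classical
  obtain ⟨r, hinj, hr⟩ := h
  let X : Finset (Finset V) := A.powerset.filter (fun S => IsMaxIndepIn G A S)
  have hX : ∀ S, S ∈ X ↔ IsMaxIndepIn G A S := by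
    intro S
    simp only [X, Finset.mem_filter, Finset.mem_powerset]
    exact ⟨fun h => h.2, fun h => ⟨h.1.1, h⟩⟩
  let Y := X.image r
  let e := Y.orderEmbOfFin rfl
  have he : ∀ i, ∃ S, IsMaxIndepIn G A S ∧ r S = e i := by
    intro i
    have := Y.orderEmbOfFin_mem rfl i
    obtain ⟨S, hS, h⟩ := Finset.mem_image.1 this
    exact ⟨S, (hX S).1 hS, h⟩
  choose F hF1 hF2 using he
  have hlt : ∀ i j, r (F i) < r (F j) ↔ i < j := by
    intro i j
    rw [hF2, hF2]; exact e.lt_iff_lt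
  have hsurj : ∀ S, IsMaxIndepIn G A S → ∃ i, F i = S := by
    intro S hS
    have : r S ∈ Set.range e := by
      rw [Finset.range_orderEmbOfFin]
      exact Finset.mem_image_of_mem _ ((hX S).2 hS)
    obtain ⟨i, hi⟩ := this
    exact ⟨i, hinj _ _ (hF1 i) hS (by rw [hF2, hi])⟩
  refine ⟨Y.card, F, ?_, ?_, ?_⟩
  · intro i j h
    apply e.injective
    rw [← hF2, ← hF2, h]
  · intro S
    refine ⟨hsurj S, ?_⟩
    rintro ⟨i, rfl⟩
    exact hF1 i
  · rintro i S hS ⟨j, hj, hSj⟩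
    obtain ⟨F'', h1, h2, p, hp, hp2, hp3⟩ := hr _ _ (hF1 i) (hF1 j) ((hlt _ _).2 hj)
    obtain ⟨k, rfl⟩ := hsurj _ h1
    refine ⟨(F i).erase p, ?_, Finset.erase_subset _ _, ⟨k, (hlt _ _).1 h2, hp3⟩,
      Finset.card_erase_of_mem hp⟩
    intro q hq
    rw [Finset.mem_erase]
    refine ⟨?_, hS hq⟩
    rintro rfl
    exact hp2 (hSj hq)

theorem IsIndepIn.subset {G : SimpleGraph V} {A A' S S' : Finset V} (h : IsIndepIn G A S)
    (h1 : S' ⊆ S) (h2 : S' ⊆ A') : IsIndepIn G A' S' :=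
  ⟨h2, fun u hu v hv => h.2 u (h1 hu) v (h1 hv)⟩

theorem IsIndepIn.exists_max {G : SimpleGraph V} {A S : Finset V} (h : IsIndepIn G A S) :
    ∃ F, IsMaxIndepIn G A F ∧ S ⊆ F := by
  classical
  let X : Finset (Finset V) := A.powerset.filter (fun T => IsIndepIn G A T ∧ S ⊆ T)
  have hX : ∀ T, T ∈ X ↔ IsIndepIn G A T ∧ S ⊆ T := by
    intro T
    simp only [X, Finset.mem_filter, Finset.mem_powerset]
    exact ⟨fun h => h.2, fun h => ⟨h.1.1, h⟩⟩
  obtain ⟨F, hF, hmax⟩ := X.exists_max_image Finset.card ⟨S, (hX S).2 ⟨h, subset_rfl⟩⟩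
  rw [hX] at hF
  refine ⟨F, ⟨hF.1, fun T hT hFT => ?_⟩, hF.2⟩
  exact Finset.eq_of_subset_of_card_le hFT (hmax T ((hX T).2 ⟨hT, hF.2.trans hFT⟩))

theorem mem_delClosedNbhd {G : SimpleGraph V} {A : Finset V} {x y : V} :
    y ∈ delClosedNbhd G A x ↔ y ∈ A ∧ y ≠ x ∧ ¬ G.Adj x y := by
  simp [delClosedNbhd]

theorem indep_insert {G : SimpleGraph V} {A S : Finset V} {x : V} (hx : x ∈ A)
    (h : IsIndepIn G A S) (hn : ∀ s ∈ S, ¬ G.Adj x s) : IsIndepIn G A (insert x S) := by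
  refine ⟨Finset.insert_subset hx h.1, ?_⟩
  intro u hu v hv
  rw [Finset.mem_insert] at hu hv
  rcases hu with rfl | hu <;> rcases hv with rfl | hv
  · exact G.irrefl
  · exact hn _ hv
  · exact fun h => hn _ hu h.symm
  · exact h.2 _ hu _ hv

theorem del_indep_insert {G : SimpleGraph V} {A S : Finset V} {x : V} (hx : x ∈ A)
    (h : IsIndepIn G (delClosedNbhd G A x) S) : IsIndepIn G A (insert x S) :=
  indep_insert hx (h.subset subset_rfl (fun s hs => (mem_delClosedNbhd.1 (h.1 hs)).1))
    (fun s hs => (mem_delClosedNbhd.1 (h.1 hs)).2.2)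

theorem indep_erase_del {G : SimpleGraph V} {A S : Finset V} {x : V} (hx : x ∈ S)
    (h : IsIndepIn G A S) : IsIndepIn G (delClosedNbhd G A x) (S.erase x) := by
  refine h.subset (Finset.erase_subset _ _) ?_
  intro s hs
  rw [Finset.mem_erase] at hs
  exact mem_delClosedNbhd.2 ⟨h.1 hs.2, hs.1, h.2 _ hx _ hs.2⟩

theorem max_insert_of_del {G : SimpleGraph V} {A F : Finset V} {x : V} (hx : x ∈ A)
    (h : IsMaxIndepIn G (delClosedNbhd G A x) F) : IsMaxIndepIn G A (insert x F) := by
  have hxF : x ∉ F := fun hh => (mem_delClosedNbhd.1 (h.1.1 hh)).2.1 rfl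
  refine ⟨del_indep_insert hx h.1, fun T hT hs => ?_⟩
  have hxT : x ∈ T := hs (Finset.mem_insert_self _ _)
  have := h.2 (T.erase x) (indep_erase_del hxT hT) (by
    intro q hq
    refine Finset.mem_erase.2 ⟨?_, hs (Finset.mem_insert_of_mem hq)⟩
    rintro rfl; exact hxF hq)
  rw [this, Finset.insert_erase hxT]

theorem max_erase_del {G : SimpleGraph V} {A F : Finset V} {x : V} (hx : x ∈ F)
    (h : IsMaxIndepIn G A F) : IsMaxIndepIn G (delClosedNbhd G A x) (F.erase x) := by
  refine ⟨indep_erase_del hx h.1, fun T hT hs => ?_⟩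
  have h1 := h.2 _ (del_indep_insert (h.1.1 hx) hT) (by
    intro q hq
    by_cases hqx : q = x
    · rw [hqx]; exact Finset.mem_insert_self _ _
    · exact Finset.mem_insert_of_mem (hs (Finset.mem_erase.2 ⟨hqx, hq⟩)))
  rw [h1, Finset.erase_insert]
  exact fun hh => (mem_delClosedNbhd.1 (hT.1 hh)).2.1 rfl

theorem ShRank.link {G : SimpleGraph V} {A : Finset V} {x : V} (hx : x ∈ A) (h : ShRank G A) :
    ShRank G (delClosedNbhd G A x) := by
  obtain ⟨r, hinj, hr⟩ := h
  have hnot : ∀ F, IsMaxIndepIn G (delClosedNbhd G A x) F → x ∉ F :=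
    fun F h hh => (mem_delClosedNbhd.1 (h.1.1 hh)).2.1 rfl
  refine ⟨fun F => r (insert x F), ?_, ?_⟩
  · intro F F' hF hF' h
    have := hinj _ _ (max_insert_of_del hx hF) (max_insert_of_del hx hF') h
    rw [← Finset.erase_insert (hnot F hF), this, Finset.erase_insert (hnot F' hF')]
  · intro F F' hF hF' h
    obtain ⟨F'', h1, h2, p, hp, hp2, hp3⟩ :=
      hr _ _ (max_insert_of_del hx hF) (max_insert_of_del hx hF') h
    rw [Finset.mem_insert, not_or] at hp2
    have hxF : x ∈ F'' := hp3 (Finset.mem_erase.2 ⟨fun h => hp2.1 h.symm, Finset.mem_insert_self _ _⟩)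
    refine ⟨F''.erase x, max_erase_del hxF h1, ?_, p, ?_, hp2.2, ?_⟩
    · simp only []
      rwa [Finset.insert_erase hxF]
    · exact (Finset.mem_insert.1 hp).resolve_left hp2.1
    · intro q hq
      rw [Finset.mem_erase] at hq
      refine Finset.mem_erase.2 ⟨?_, hp3 (Finset.mem_erase.2 ⟨hq.1, Finset.mem_insert_of_mem hq.2⟩)⟩
      rintro rfl
      exact hnot F hF hq.2

theorem ShRank.edgeless {G : SimpleGraph V} {A : Finset V}
    (h : ∀ u ∈ A, ∀ v ∈ A, ¬G.Adj u v) : ShRank G A := by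
  refine ⟨fun _ => 0, ?_, fun _ _ _ _ h => absurd h (lt_irrefl _)⟩
  have hA : ∀ F, IsMaxIndepIn G A F → F = A := fun F hF => hF.2 A ⟨subset_rfl, h⟩ hF.1.1
  intro F F' hF hF' _
  rw [hA F hF, hA F' hF']

theorem ShRank.shed {G : SimpleGraph V} {A : Finset V} {x : V} (hx : x ∈ A)
    (hlink : ShRank G (delClosedNbhd G A x)) (hdel : ShRank G (A.erase x))
    (hexch : ∀ S, IsIndepIn G (delClosedNbhd G A x) S →
        ∃ y ∈ A, G.Adj x y ∧ IsIndepIn G (A.erase x) (insert y S)) : ShRank G A := by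
  classical
  obtain ⟨r1, hi1, hr1⟩ := hdel
  obtain ⟨r2, hi2, hr2⟩ := hlink
  -- facets avoiding `x`
  have up : ∀ F, IsMaxIndepIn G (A.erase x) F → IsMaxIndepIn G A F := by
    intro F hF
    refine ⟨hF.1.subset subset_rfl (hF.1.1.trans (Finset.erase_subset _ _)), fun T hT hs => ?_⟩
    by_cases hxT : x ∈ T
    · exfalso
      have h1 : IsIndepIn G (delClosedNbhd G A x) F :=
        (indep_erase_del hxT hT).subset (S' := F) (by
          intro q hq
          exact Finset.mem_erase.2 ⟨(Finset.mem_erase.1 (hF.1.1 hq)).1, hs hq⟩) (by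
          intro q hq
          exact (indep_erase_del hxT hT).1 (
            Finset.mem_erase.2 ⟨(Finset.mem_erase.1 (hF.1.1 hq)).1, hs hq⟩))
      obtain ⟨y, hy, hxy, hI⟩ := hexch F h1
      have := hF.2 _ hI (Finset.subset_insert _ _)
      have hyF : y ∈ F := by rw [this]; exact Finset.mem_insert_self _ _
      exact hT.2 _ hxT _ (hs hyF) hxy
    · refine hF.2 T (hT.subset subset_rfl ?_) hs
      intro q hq
      refine Finset.mem_erase.2 ⟨?_, hT.1 hq⟩
      rintro rfl; exact hxT hq
  have down : ∀ F, IsMaxIndepIn G A F → x ∉ F → IsMaxIndepIn G (A.erase x) F := by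
    intro F hF hxF
    refine ⟨hF.1.subset subset_rfl ?_, fun T hT hs => ?_⟩
    · intro q hq
      refine Finset.mem_erase.2 ⟨?_, hF.1.1 hq⟩
      rintro rfl; exact hxF hq
    · exact hF.2 T (hT.subset subset_rfl (hT.1.trans (Finset.erase_subset _ _))) hs
  obtain ⟨N, hN⟩ : ∃ N, ∀ F, IsMaxIndepIn G A F → r1 F < N := by
    refine ⟨A.powerset.sup r1 + 1, fun F hF => ?_⟩
    have := Finset.le_sup (f := r1) (Finset.mem_powerset.2 hF.1.1)
    omega
  let r : Finset V → ℕ := fun F => if x ∈ F then N + r2 (F.erase x) else r1 F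
  have ra : ∀ F, x ∈ F → r F = N + r2 (F.erase x) := fun F h => by simp only [r, h, if_true]
  have rb : ∀ F, x ∉ F → r F = r1 F := fun F h => by simp only [r, h, if_false]
  refine ⟨r, ?_, ?_⟩
  · intro F F' hF hF' h
    by_cases h1 : x ∈ F <;> by_cases h2 : x ∈ F'
    · rw [ra F h1, ra F' h2] at h
      have := hi2 _ _ (max_erase_del h1 hF) (max_erase_del h2 hF') (by omega)
      rw [← Finset.insert_erase h1, this, Finset.insert_erase h2]
    · rw [ra F h1, rb F' h2] at h
      have := hN F' hF'
      omega
    · rw [rb F h1, ra F' h2] at h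
      have := hN F hF
      omega
    · rw [rb F h1, rb F' h2] at h
      exact hi1 _ _ (down F hF h1) (down F' hF' h2) h
  · intro F F' hF hF' h
    by_cases h1 : x ∈ F <;> by_cases h2 : x ∈ F'
    · rw [ra F h1, ra F' h2] at h
      obtain ⟨F'', k1, k2, p, hp, hp2, hp3⟩ :=
        hr2 _ _ (max_erase_del h1 hF) (max_erase_del h2 hF') (by omega)
      have hxF : x ∉ F'' := fun hh => (mem_delClosedNbhd.1 (k1.1.1 hh)).2.1 rfl
      rw [Finset.mem_erase] at hp
      refine ⟨insert x F'', max_insert_of_del hx k1, ?_, p, hp.2, ?_, ?_⟩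
      · rw [ra _ (Finset.mem_insert_self _ _), ra F h1, Finset.erase_insert hxF]
        omega
      · intro hh
        exact hp2 (Finset.mem_erase.2 ⟨hp.1, hh⟩)
      · intro q hq
        rw [Finset.mem_erase] at hq
        by_cases hqx : q = x
        · rw [hqx]; exact Finset.mem_insert_self _ _
        · exact Finset.mem_insert_of_mem (hp3 (by simp [hq, hqx]))
    · have hI : IsIndepIn G (A.erase x) (F.erase x) :=
        hF.1.subset (Finset.erase_subset _ _) (Finset.erase_subset_erase _ hF.1.1)
      obtain ⟨F'', k1, k2⟩ := hI.exists_max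
      have hxF : x ∉ F'' := fun hh => (Finset.mem_erase.1 (k1.1.1 hh)).1 rfl
      refine ⟨F'', up _ k1, ?_, x, h1, h2, k2⟩
      rw [ra F h1, rb _ hxF]
      have := hN _ (up _ k1)
      omega
    · rw [rb F h1, ra F' h2] at h
      have := hN F hF
      omega
    · rw [rb F h1, rb F' h2] at h
      obtain ⟨F'', k1, k2, p, hp, hp2, hp3⟩ :=
        hr1 _ _ (down F hF h1) (down F' hF' h2) h
      have hxF : x ∉ F'' := fun hh => (Finset.mem_erase.1 (k1.1.1 hh)).1 rfl
      exact ⟨F'', up _ k1, by rw [rb F h1, rb _ hxF]; exact k2, p, hp, hp2, hp3⟩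

/-- Shedding through a neighbour `z` with `N[z] ⊆ N[x]`. -/
theorem ShRank.shed_simplicial {G : SimpleGraph V} {A : Finset V} {x z : V} (hx : x ∈ A)
    (hz : z ∈ A) (hxz : G.Adj x z) (hN : ∀ u ∈ A, G.Adj z u → u = x ∨ G.Adj x u)
    (hlink : ShRank G (delClosedNbhd G A x)) (hdel : ShRank G (A.erase x)) : ShRank G A := by
  refine ShRank.shed hx hlink hdel fun S hS => ⟨z, hz, hxz, ?_⟩
  refine indep_insert (Finset.mem_erase.2 ⟨hxz.ne', hz⟩) (hS.subset subset_rfl ?_) ?_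
  · intro s hs
    have := mem_delClosedNbhd.1 (hS.1 hs)
    exact Finset.mem_erase.2 ⟨this.2.1, this.1⟩
  · intro s hs hzs
    have := mem_delClosedNbhd.1 (hS.1 hs)
    rcases hN s this.1 hzs with h | h
    · exact this.2.1 h
    · exact this.2.2 h

theorem ShRank.link_set {G : SimpleGraph V} {A : Finset V} (h : ShRank G A) :
    ∀ S : Finset V, IsIndepIn G A S →
      ∀ A' : Finset V, (∀ y, y ∈ A' ↔ y ∈ A ∧ ∀ s ∈ S, y ≠ s ∧ ¬ G.Adj s y) → ShRank G A' := by
  intro S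
  induction S using Finset.induction_on with
  | empty =>
    intro _ A' hA'
    have : A' = A := by ext y; rw [hA']; simp
    rw [this]; exact h
  | insert a S ha ih =>
    intro hS A' hA'
    classical
    have h1 := ih (hS.subset (Finset.subset_insert _ _) ((Finset.subset_insert _ _).trans hS.1))
      (A.filter (fun y => ∀ s ∈ S, y ≠ s ∧ ¬ G.Adj s y)) (fun y => by rw [Finset.mem_filter])
    have h2 : a ∈ A.filter (fun y => ∀ s ∈ S, y ≠ s ∧ ¬ G.Adj s y) := by
      rw [Finset.mem_filter]
      refine ⟨hS.1 (Finset.mem_insert_self _ _), fun s hs => ⟨?_, ?_⟩⟩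
      · rintro rfl; exact ha hs
      · exact hS.2 _ (Finset.mem_insert_of_mem hs) _ (Finset.mem_insert_self _ _)
    have h3 := h1.link h2
    convert h3 using 1
    ext y
    rw [hA', mem_delClosedNbhd, Finset.mem_filter, Finset.forall_mem_insert]
    tauto

/-- A cyclic labelling of the vertex set `B` by `0, …, m - 1`. -/
def CycLab (H : SimpleGraph V) (B : Finset V) (m : ℕ) (d : ℕ → V) : Prop :=
  (∀ y, y ∈ B ↔ ∃ i < m, d i = y) ∧
  (∀ i < m, ∀ j < m, d i = d j → i = j) ∧
  ∀ i < m, ∀ j < m, H.Adj (d i) (d j) ↔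
    (j = i + 1 ∨ i = j + 1 ∨ (i = 0 ∧ j + 1 = m) ∨ (j = 0 ∧ i + 1 = m))

/-- rotation of a labelling -/
def rotLab (m s : ℕ) (d : ℕ → V) : ℕ → V := fun i => d (if i + s < m then i + s else i + s - m)

theorem CycLab.rot {H : SimpleGraph V} {B : Finset V} {m s : ℕ} {d : ℕ → V}
    (h : CycLab H B m d) (hm : 3 ≤ m) (hs : s < m) : CycLab H B m (rotLab m s d) := by
  obtain ⟨h1, h2, h3⟩ := h
  refine ⟨fun y => ?_, ?_, ?_⟩
  · rw [h1]
    constructor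
    · rintro ⟨i, hi, rfl⟩
      by_cases hh : s ≤ i
      · refine ⟨i - s, by omega, ?_⟩
        unfold rotLab
        congr 1
        split_ifs <;> omega
      · refine ⟨i + m - s, by omega, ?_⟩
        unfold rotLab
        congr 1
        split_ifs <;> omega
    · rintro ⟨i, hi, rfl⟩
      exact ⟨_, by split_ifs <;> omega, rfl⟩
  · intro i hi j hj h
    have := h2 _ (by split_ifs <;> omega) _ (by split_ifs <;> omega) h
    split_ifs at this <;> omega
  · intro i hi j hj
    unfold rotLab
    rw [h3 _ (by split_ifs <;> omega) _ (by split_ifs <;> omega)]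
    split_ifs <;> omega

theorem exists_cycLab {H : SimpleGraph V} {B : Finset V} {m : ℕ} (hm : 3 ≤ m)
    (h : IsCycleGraphOn H B m) {v : V} (hv : v ∈ B) : ∃ d, CycLab H B m d ∧ d 0 = v := by
  obtain ⟨-, ⟨e⟩⟩ := h
  let d0 : ℕ → V := fun i => if h : i < m then ((e.symm ⟨i, h⟩ : (B : Set V)) : V) else v
  have hd : ∀ i (h : i < m), d0 i = ((e.symm ⟨i, h⟩ : (B : Set V)) : V) := by
    intro i h; simp only [d0, h, dif_pos]
  have h0 : CycLab H B m d0 := by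
    refine ⟨fun y => ?_, ?_, ?_⟩
    · constructor
      · intro hy
        refine ⟨(e ⟨y, hy⟩ : Fin m), (e ⟨y, hy⟩).2, ?_⟩
        rw [hd _ (e ⟨y, hy⟩).2]
        simp
      · rintro ⟨i, hi, rfl⟩
        rw [hd i hi]
        exact (e.symm ⟨i, hi⟩).2
    · intro i hi j hj h
      rw [hd i hi, hd j hj] at h
      have := e.symm.injective (Subtype.ext h)
      exact congrArg Fin.val this
    · intro i hi j hj
      rw [hd i hi, hd j hj]
      have := e.symm.map_adj_iff (v := (⟨i, hi⟩ : Fin m)) (w := ⟨j, hj⟩)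
      rw [SimpleGraph.cycleGraph_adj'] at this
      simp only [SimpleGraph.comap_adj, Function.Embedding.subtype_apply] at this
      refine this.trans ?_
      rw [Fin.sub_def, Fin.sub_def]
      simp only []
      rcases lt_trichotomy i j with hij | hij | hij
      · rw [Nat.mod_eq_of_lt (show m - j + i < m by omega),
          show m - i + j = (j - i) + m by omega, Nat.add_mod_right, Nat.mod_eq_of_lt (by omega)]
        omega
      · subst hij
        rw [show m - i + i = m by omega, Nat.mod_self]
        omega
      · rw [Nat.mod_eq_of_lt (show m - i + j < m by omega),
          show m - j + i = (i - j) + m by omega, Nat.add_mod_right, Nat.mod_eq_of_lt (by omega)]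
        omega
  obtain ⟨s, hs, hsv⟩ := (h0.1 v).1 hv
  refine ⟨rotLab m s d0, h0.rot hm hs, ?_⟩
  simp only [rotLab, Nat.zero_add, hs, if_true]
  exact hsv

theorem cyc_even_not_shRank {H : SimpleGraph V} {B : Finset V} {k : ℕ} (hk : 2 ≤ k) {d : ℕ → V}
    (h : CycLab H B (2 * k) d) : ¬ ShRank H B := by
  classical
  rintro ⟨r, hinj, hr⟩
  obtain ⟨h1, h2, h3⟩ := h
  let T : ℕ → Finset V := fun a => (Finset.range k).image (fun i => d (2 * i + a))
  have hT : ∀ a < 2, ∀ i < 2 * k, (d i ∈ T a ↔ i % 2 = a) := by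
    intro a ha i hi
    simp only [T, Finset.mem_image, Finset.mem_range]
    constructor
    · rintro ⟨j, hj, hji⟩
      have := h2 _ (by omega) _ hi hji
      omega
    · intro h
      exact ⟨i / 2, by omega, by congr 1; omega⟩
  have hTB : ∀ a < 2, T a ⊆ B := by
    intro a ha y hy
    simp only [T, Finset.mem_image, Finset.mem_range] at hy
    obtain ⟨j, hj, rfl⟩ := hy
    exact (h1 _).2 ⟨_, by omega, rfl⟩
  have hmax : ∀ a < 2, IsMaxIndepIn H B (T a) := by
    intro a ha
    refine ⟨⟨hTB a ha, ?_⟩, ?_⟩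
    · intro u hu v hv huv
      obtain ⟨i, hi, rfl⟩ := (h1 u).1 (hTB a ha hu)
      obtain ⟨j, hj, rfl⟩ := (h1 v).1 (hTB a ha hv)
      rw [hT a ha i hi] at hu
      rw [hT a ha j hj] at hv
      rw [h3 i hi j hj] at huv
      omega
    · intro S hS hTS
      refine subset_antisymm hTS fun y hy => ?_
      obtain ⟨i, hi, rfl⟩ := (h1 y).1 (hS.1 hy)
      rw [hT a ha i hi]
      by_contra hne
      obtain ⟨j, hj, hja, hij⟩ : ∃ j < 2 * k, j % 2 = a ∧ (j = i + 1 ∨ i = j + 1) := by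
        by_cases h0 : i = 0
        · exact ⟨1, by omega, by omega, by omega⟩
        · exact ⟨i - 1, by omega, by omega, by omega⟩
      refine hS.2 _ hy _ (hTS ((hT a ha j hj).2 hja)) ?_
      rw [h3 i hi j hj]; omega
  have key : ∀ a < 2, ∀ b < 2, a ≠ b → ¬ r (T b) < r (T a) := by
    intro a ha b hb hab hlt
    obtain ⟨F, hF, hrF, p, hp, hp2, hpF⟩ := hr _ _ (hmax a ha) (hmax b hb) hlt
    obtain ⟨i, hi, rfl⟩ := (h1 p).1 (hTB a ha hp)
    rw [hT a ha i hi] at hp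
    have : F = T a := by
      apply hF.2 _ (hmax a ha).1
      intro y hy
      obtain ⟨j, hj, rfl⟩ := (h1 y).1 (hF.1.1 hy)
      rw [hT a ha j hj]
      by_contra hne
      obtain ⟨l, hl, hla, hli, hjl⟩ : ∃ l < 2 * k, l % 2 = a ∧ l ≠ i ∧
          (l = j + 1 ∨ j = l + 1 ∨ (j = 0 ∧ l + 1 = 2 * k) ∨ (l = 0 ∧ j + 1 = 2 * k)) := by
        by_cases hc : j ≠ 0 ∧ i ≠ j - 1
        · exact ⟨j - 1, by omega, by omega, by omega, by omega⟩
        · by_cases hc2 : j + 1 < 2 * k ∧ i ≠ j + 1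
          · exact ⟨j + 1, by omega, by omega, by omega, by omega⟩
          · by_cases h0 : j = 0
            · exact ⟨2 * k - 1, by omega, by omega, by omega, by omega⟩
            · exact ⟨0, by omega, by omega, by omega, by omega⟩
      refine hF.1.2 _ hy _ (hpF (Finset.mem_erase.2 ⟨?_, (hT a ha l hl).2 hla⟩)) ?_
      · intro hh; exact hli (h2 _ hl _ hi hh)
      · rw [h3 j hj l hl]; omega
    rw [this] at hrF
    exact lt_irrefl _ hrF
  rcases lt_trichotomy (r (T 0)) (r (T 1)) with hlt | heq | hlt
  · exact key 1 (by omega) 0 (by omega) (by omega) hlt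
  · have := hinj _ _ (hmax 0 (by omega)) (hmax 1 (by omega)) heq
    have h4 := (hT 0 (by omega) 0 (by omega)).2 rfl
    rw [this, hT 1 (by omega) 0 (by omega)] at h4
    omega
  · exact key 0 (by omega) 1 (by omega) (by omega) hlt

/-- The facet `{d 0, d 2, …, d (2k - 2)}`. -/
def oddT (k : ℕ) (d : ℕ → V) : Finset V := (Finset.range k).image (fun i => d (2 * i))

theorem oddT_mem {H : SimpleGraph V} {B : Finset V} {k : ℕ} {d : ℕ → V}
    (h : CycLab H B (2 * k + 1) d) {i : ℕ} (hi : i < 2 * k + 1) :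
    d i ∈ oddT k d ↔ i % 2 = 0 ∧ i < 2 * k := by
  simp only [oddT, Finset.mem_image, Finset.mem_range]
  constructor
  · rintro ⟨j, hj, hji⟩
    have := h.2.1 _ (by omega) _ hi hji
    omega
  · intro h
    exact ⟨i / 2, by omega, by congr 1; omega⟩

theorem oddT_mem_rot {H : SimpleGraph V} {B : Finset V} {k : ℕ} {d : ℕ → V} (hk : 3 ≤ k)
    (h : CycLab H B (2 * k + 1) d) {s i : ℕ} (hi : i < 2 * k + 1) (hs : s < 2 * k + 1) :
    d i ∈ oddT k (rotLab (2 * k + 1) s d) ↔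
      (s ≤ i ∧ (i - s) % 2 = 0 ∧ i - s < 2 * k) ∨
      (i < s ∧ (i + (2 * k + 1) - s) % 2 = 0 ∧ i + (2 * k + 1) - s < 2 * k) := by
  by_cases hh : s ≤ i
  · have : d i = rotLab (2 * k + 1) s d (i - s) := by
      unfold rotLab
      congr 1
      split_ifs <;> omega
    rw [this, oddT_mem (h.rot (by omega) hs) (by omega)]
    omega
  · have : d i = rotLab (2 * k + 1) s d (i + (2 * k + 1) - s) := by
      unfold rotLab
      congr 1
      split_ifs <;> omega
    rw [this, oddT_mem (h.rot (by omega) hs) (by omega)]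
    omega

theorem oddT_max {H : SimpleGraph V} {B : Finset V} {k : ℕ} {d : ℕ → V} (hk : 3 ≤ k)
    (h : CycLab H B (2 * k + 1) d) : IsMaxIndepIn H B (oddT k d) := by
  have hTB : oddT k d ⊆ B := by
    intro y hy
    simp only [oddT, Finset.mem_image, Finset.mem_range] at hy
    obtain ⟨j, hj, rfl⟩ := hy
    exact (h.1 _).2 ⟨_, by omega, rfl⟩
  refine ⟨⟨hTB, ?_⟩, ?_⟩
  · intro u hu v hv huv
    obtain ⟨i, hi, rfl⟩ := (h.1 u).1 (hTB hu)
    obtain ⟨j, hj, rfl⟩ := (h.1 v).1 (hTB hv)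
    rw [oddT_mem h hi] at hu
    rw [oddT_mem h hj] at hv
    rw [h.2.2 i hi j hj] at huv
    omega
  · intro S hS hTS
    refine subset_antisymm hTS fun y hy => ?_
    obtain ⟨i, hi, rfl⟩ := (h.1 y).1 (hS.1 hy)
    rw [oddT_mem h hi]
    by_contra hne
    obtain ⟨j, hj, hja, hij⟩ : ∃ j < 2 * k + 1, (j % 2 = 0 ∧ j < 2 * k) ∧
        (i = j + 1 ∨ (i + 1 = 2 * k + 1 ∧ j = 0)) := by
      by_cases h0 : i = 2 * k
      · exact ⟨0, by omega, by omega, by omega⟩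
      · exact ⟨i - 1, by omega, by omega, by omega⟩
    refine hS.2 _ hy _ (hTS ((oddT_mem h hj).2 hja)) ?_
    rw [h.2.2 i hi j hj]; omega

theorem cyc_odd_not_shRank {H : SimpleGraph V} {B : Finset V} {k : ℕ} (hk : 3 ≤ k) {d₀ : ℕ → V}
    (h₀ : CycLab H B (2 * k + 1) d₀) : ¬ ShRank H B := by
  classical
  rintro ⟨r, hinj, hr⟩
  obtain ⟨d, h, hdmax⟩ : ∃ d, CycLab H B (2 * k + 1) d ∧
      ∀ d', CycLab H B (2 * k + 1) d' → r (oddT k d') ≤ r (oddT k d) := by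
    have hb : BddAbove {n : ℕ | ∃ d, CycLab H B (2 * k + 1) d ∧ r (oddT k d) = n} := by
      refine ⟨B.powerset.sup r, ?_⟩
      rintro _ ⟨d, hd, rfl⟩
      exact Finset.le_sup (f := r) (Finset.mem_powerset.2 (oddT_max hk hd).1.1)
    obtain ⟨d, hd, he⟩ := Nat.sSup_mem (s := {n : ℕ | ∃ d, CycLab H B (2 * k + 1) d ∧ r (oddT k d) = n})
      ⟨_, d₀, h₀, rfl⟩ hb
    exact ⟨d, hd, fun d' hd' => by rw [he]; exact le_csSup hb ⟨d', hd', rfl⟩⟩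
  have hA := h.rot (s := 2) (by omega) (by omega)
  have hB := h.rot (s := 2 * k - 1) (by omega) (by omega)
  have m0 := oddT_max hk h
  have mA := oddT_max hk hA
  have mB := oddT_max hk hB
  have lA := hdmax _ hA
  have lB := hdmax _ hB
  have e0 : ∀ i < 2 * k + 1, (d i ∈ oddT k d ↔ i % 2 = 0 ∧ i < 2 * k) := fun i hi => oddT_mem h hi
  have eA : ∀ i < 2 * k + 1, (d i ∈ oddT k (rotLab (2 * k + 1) 2 d) ↔ i % 2 = 0 ∧ 2 ≤ i) := by
    intro i hi
    rw [oddT_mem_rot hk h hi (by omega)]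
    omega
  have eB : ∀ i < 2 * k + 1, (d i ∈ oddT k (rotLab (2 * k + 1) (2 * k - 1) d) ↔
      i = 2 * k - 1 ∨ (i % 2 = 0 ∧ i < 2 * k - 2)) := by
    intro i hi
    rw [oddT_mem_rot hk h hi (by omega)]
    omega
  generalize oddT k d = F0 at *
  generalize oddT k (rotLab (2 * k + 1) 2 d) = FA at *
  generalize oddT k (rotLab (2 * k + 1) (2 * k - 1) d) = FB at *
  -- generic tool: an element of a facet is not adjacent to a kept element
  have tool : ∀ (F T : Finset V) (i : ℕ), i < 2 * k + 1 → IsMaxIndepIn H B F → T.erase (d i) ⊆ F →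
      ∀ j < 2 * k + 1, d j ∈ F → ∀ l < 2 * k + 1, d l ∈ T → l ≠ i →
      ¬ (l = j + 1 ∨ j = l + 1 ∨ (j = 0 ∧ l + 1 = 2 * k + 1) ∨ (l = 0 ∧ j + 1 = 2 * k + 1)) := by
    intro F T i hi hF hs j hj hjF l hl hlT hli hadj
    refine hF.1.2 _ hjF _ (hs (Finset.mem_erase.2 ⟨fun hh => hli (h.2.1 _ hl _ hi hh), hlT⟩)) ?_
    rw [h.2.2 j hj l hl]; omega
  have refill : ∀ (F T : Finset V) (i : ℕ), T.erase (d i) ⊆ F → d i ∈ F → T ⊆ F := by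
    intro F T i hs hi y hy
    by_cases hyi : y = d i
    · rw [hyi]; exact hi
    · exact hs (Finset.mem_erase.2 ⟨hyi, hy⟩)
  rcases lt_trichotomy (r FB) (r FA) with hlt | heq | hlt
  · obtain ⟨F, hF, hrF, p, hp, hp2, hpF⟩ := hr _ _ mA mB hlt
    obtain ⟨i, hi, rfl⟩ := (h.1 p).1 (mA.1.1 hp)
    rw [eA i hi] at hp
    rw [eB i hi] at hp2
    have tl := tool F FA i hi hF hpF
    have hi' : i = 2 * k ∨ i = 2 * k - 2 := by omega
    rcases hi' with hi' | hi'
    · by_cases hin : d i ∈ F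
      · have := mA.2 F hF.1 (refill _ _ _ hpF hin)
        rw [this] at hrF; exact lt_irrefl _ hrF
      · have : F = F0 := by
          apply hF.2 _ m0.1
          intro y hy
          obtain ⟨j, hj, rfl⟩ := (h.1 y).1 (hF.1.1 hy)
          rw [e0 j hj]
          by_contra hne
          by_cases hji : j = i
          · rw [hji] at hy; exact hin hy
          by_cases hj1 : j = 1
          · exact tl j hj hy 2 (by omega) ((eA _ (by omega)).2 (by omega)) (by omega) (by omega)
          · exact tl j hj hy (j - 1) (by omega) ((eA _ (by omega)).2 (by omega)) (by omega)
              (by omega)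
        rw [this] at hrF
        omega
    · have : F = FA := by
        apply hF.2 _ mA.1
        intro y hy
        obtain ⟨j, hj, rfl⟩ := (h.1 y).1 (hF.1.1 hy)
        rw [eA j hj]
        by_contra hne
        by_cases hj1 : j = 0 ∨ j = 2 * k - 1
        · exact tl j hj hy (2 * k) (by omega) ((eA _ (by omega)).2 (by omega)) (by omega) (by omega)
        by_cases hj1 : j = 1
        · exact tl j hj hy 2 (by omega) ((eA _ (by omega)).2 (by omega)) (by omega) (by omega)
        · exact tl j hj hy (j - 1) (by omega) ((eA _ (by omega)).2 (by omega)) (by omega)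
            (by omega)
      rw [this] at hrF
      exact lt_irrefl _ hrF
  · have := hinj _ _ mB mA heq
    have h4 := (eB 0 (by omega)).2 (by omega)
    rw [this, eA 0 (by omega)] at h4
    omega
  · obtain ⟨F, hF, hrF, p, hp, hp2, hpF⟩ := hr _ _ mB mA hlt
    obtain ⟨i, hi, rfl⟩ := (h.1 p).1 (mB.1.1 hp)
    rw [eB i hi] at hp
    rw [eA i hi] at hp2
    have tl := tool F FB i hi hF hpF
    have hi' : i = 2 * k - 1 ∨ i = 0 := by omega
    rcases hi' with hi' | hi'
    · by_cases hin : d i ∈ F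
      · have := mB.2 F hF.1 (refill _ _ _ hpF hin)
        rw [this] at hrF; exact lt_irrefl _ hrF
      · have : F = F0 := by
          apply hF.2 _ m0.1
          intro y hy
          obtain ⟨j, hj, rfl⟩ := (h.1 y).1 (hF.1.1 hy)
          rw [e0 j hj]
          by_contra hne
          by_cases hji : j = i
          · rw [hji] at hy; exact hin hy
          by_cases hj1 : j = 2 * k
          · exact tl j hj hy 0 (by omega) ((eB _ (by omega)).2 (by omega)) (by omega) (by omega)
          · exact tl j hj hy (j - 1) (by omega) ((eB _ (by omega)).2 (by omega)) (by omega)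
              (by omega)
        rw [this] at hrF
        omega
    · have : F = FB := by
        apply hF.2 _ mB.1
        intro y hy
        obtain ⟨j, hj, rfl⟩ := (h.1 y).1 (hF.1.1 hy)
        rw [eB j hj]
        by_contra hne
        by_cases hj1 : j = 2 * k ∨ j = 2 * k - 2
        · exact tl j hj hy (2 * k - 1) (by omega) ((eB _ (by omega)).2 (by omega)) (by omega)
            (by omega)
        by_cases hj1 : j = 1
        · exact tl j hj hy 2 (by omega) ((eB _ (by omega)).2 (by omega)) (by omega) (by omega)
        · exact tl j hj hy (j - 1) (by omega) ((eB _ (by omega)).2 (by omega)) (by omega)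
            (by omega)
      rw [this] at hrF
      exact lt_irrefl _ hrF

theorem cyc_shRank_length {H : SimpleGraph V} {B : Finset V} {m : ℕ} (hm : 3 ≤ m) {d : ℕ → V}
    (h : CycLab H B m d) (hs : ShRank H B) : m = 3 ∨ m = 5 := by
  by_contra hne
  rcases Nat.even_or_odd' m with ⟨k, hk | hk⟩
  · subst hk
    exact cyc_even_not_shRank (by omega) h hs
  · subst hk
    exact cyc_odd_not_shRank (by omega) h hs

theorem shortest_edge {K : SimpleGraph V} {a b : V} (p : K.Walk a b) (hp : p.length = K.dist a b)
    {u w : V} (hu : u ∈ p.support) (hw : w ∈ p.support) (h : K.Adj u w) : s(u, w) ∈ p.edges := by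
  have main : ∀ i j, i < j → j ≤ p.length → K.Adj (p.getVert i) (p.getVert j) →
      s(p.getVert i, p.getVert j) ∈ p.edges := by
    intro i j hij hj hadj
    have h1 := K.dist_le (((p.take i).concat hadj).append (p.drop j))
    have h2 : (((p.take i).concat hadj).append (p.drop j)).length = i + 1 + (p.length - j) := by
      simp [SimpleGraph.Walk.length_append, SimpleGraph.Walk.take_length,
        SimpleGraph.Walk.drop_length]
      omega
    have : j = i + 1 := by omega
    subst this
    exact (SimpleGraph.Walk.mk_mem_edges_iff_exists p).2 ⟨i, by omega, rfl⟩
  obtain ⟨i, rfl, hi⟩ := SimpleGraph.Walk.mem_support_iff_exists_getVert.1 hu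
  obtain ⟨j, rfl, hj⟩ := SimpleGraph.Walk.mem_support_iff_exists_getVert.1 hw
  rcases lt_trichotomy i j with hij | hij | hij
  · exact main i j hij hj h
  · subst hij; exact absurd h K.irrefl
  · rw [Sym2.eq_swap]; exact main j i hij hi h.symm

/-- `K` restricted to the vertices satisfying `W`. -/
def resG (K : SimpleGraph V) (W : V → Prop) : SimpleGraph V where
  Adj u v := K.Adj u v ∧ W u ∧ W v
  symm := ⟨fun _ _ h => ⟨h.1.symm, h.2.2, h.2.1⟩⟩
  loopless := ⟨fun _ h => K.irrefl h.1⟩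

theorem resG_support {K : SimpleGraph V} {W : V → Prop} {a b : V} (p : (resG K W).Walk a b)
    (ha : W a) : ∀ u ∈ p.support, W u := by
  induction p with
  | nil => intro u hu; simp at hu; rw [hu]; exact ha
  | cons h q ih =>
    intro u hu
    rw [SimpleGraph.Walk.support_cons, List.mem_cons] at hu
    rcases hu with rfl | hu
    · exact ha
    · exact ih h.2.2 u hu

/-- In a chordal graph, two neighbours of `v` joined through non-neighbours of `v` are adjacent. -/
theorem chordal_sep {K : SimpleGraph V} (hK : IsChordal K) {R : V → Prop} {v a b : V}
    (hR : ∀ u, R u → u ≠ v ∧ ¬ K.Adj v u) (hva : K.Adj v a) (hvb : K.Adj v b) (hab : a ≠ b)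
    (hreach : (resG K (fun u => R u ∨ u = a ∨ u = b)).Reachable a b) : K.Adj a b := by
  by_contra hnab
  set K' := resG K (fun u => R u ∨ u = a ∨ u = b) with hK'
  have hle : K' ≤ K := fun u w h => h.1
  obtain ⟨p, hpath, hp⟩ := hreach.exists_path_of_dist
  have hsup := resG_support p (Or.inr (Or.inl rfl))
  have hvp : v ∉ p.support := by
    intro hh
    rcases hsup v hh with h | h | h
    · exact (hR v h).1 rfl
    · exact hva.ne h
    · exact hvb.ne h
  have hlen : 2 ≤ p.length := by
    by_contra hlt
    have : p.length = 0 ∨ p.length = 1 := by omega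
    rcases this with h | h
    · exact hab (SimpleGraph.Walk.eq_of_length_eq_zero h)
    · exact hnab (hle (SimpleGraph.Walk.adj_of_length_eq_one h))
  let q : K.Walk v a := SimpleGraph.Walk.cons hvb (p.mapLe hle).reverse
  have hq : q.IsPath := by
    rw [SimpleGraph.Walk.cons_isPath_iff]
    refine ⟨((SimpleGraph.Walk.isPath_mapLe hle).2 hpath).reverse, ?_⟩
    rw [SimpleGraph.Walk.support_reverse, List.mem_reverse,
      SimpleGraph.Walk.support_mapLe_eq_support]
    exact hvp
  let c : K.Walk a a := SimpleGraph.Walk.cons hva.symm q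
  have hc : c.IsCycle := by
    rw [SimpleGraph.Walk.cons_isCycle_iff]
    refine ⟨hq, ?_⟩
    intro hh
    simp only [q, SimpleGraph.Walk.edges_cons, List.mem_cons, SimpleGraph.Walk.edges_reverse,
      List.mem_reverse, SimpleGraph.Walk.edges_mapLe_eq_edges] at hh
    rcases hh with hh | hh
    · rw [Sym2.eq_iff] at hh
      rcases hh with ⟨h1, h2⟩ | ⟨h1, h2⟩
      · exact hva.ne h1.symm
      · exact hab h1
    · exact hvp (SimpleGraph.Walk.snd_mem_support_of_mem_edges _ hh)
  obtain ⟨u, w, hu, hw, huw, hne⟩ := hK a c hc (by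
    simp only [c, q, SimpleGraph.Walk.length_cons, SimpleGraph.Walk.length_reverse,
      SimpleGraph.Walk.length_mapLe]
    omega)
  simp only [c, q, SimpleGraph.Walk.support_cons, SimpleGraph.Walk.support_reverse, List.mem_cons,
    List.mem_reverse, SimpleGraph.Walk.support_mapLe_eq_support] at hu hw
  simp only [c, q, SimpleGraph.Walk.edges_cons, List.mem_cons, SimpleGraph.Walk.edges_reverse,
      List.mem_reverse, SimpleGraph.Walk.edges_mapLe_eq_edges, not_or] at hne
  have hmem : ∀ y, (y = a ∨ y = v ∨ y ∈ p.support) → y = v ∨ y ∈ p.support := by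
    rintro y (rfl | h | h)
    · exact Or.inr p.start_mem_support
    · exact Or.inl h
    · exact Or.inr h
  have hvcase : ∀ y, y ∈ p.support → K.Adj v y → y = a ∨ y = b := by
    intro y hy hvy
    rcases hsup y hy with h | h
    · exact absurd hvy (hR y h).2
    · exact h
  rcases hmem u hu with rfl | hu' <;> rcases hmem w hw with rfl | hw'
  · exact K.irrefl huw
  · rcases hvcase w hw' huw with rfl | rfl
    · exact hne.1 Sym2.eq_swap
    · exact hne.2.1 rfl
  · rcases hvcase u hu' huw.symm with rfl | rfl
    · exact hne.1 rfl
    · exact hne.2.1 Sym2.eq_swap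
  · exact hne.2.2 (shortest_edge p hp hu' hw' ⟨huw, hsup u hu', hsup w hw'⟩)

/-- `z` is simplicial in the induced subgraph on `A`. -/
def SimpIn (K : SimpleGraph V) (A : Finset V) (z : V) : Prop :=
  ∀ u ∈ A, ∀ w ∈ A, K.Adj z u → K.Adj z w → u ≠ w → K.Adj u w

theorem chordal_step {K : SimpleGraph V} (hK : IsChordal K) {A : Finset V}
    (ih : ∀ A' : Finset V, A' ⊂ A → ∀ Q ⊂ A', (∀ u ∈ Q, ∀ w ∈ Q, u ≠ w → K.Adj u w) →
      ∃ z ∈ A', z ∉ Q ∧ SimpIn K A' z) {v d0 : V} (hv : v ∈ A) (hd0 : d0 ∈ A)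
    (hne : d0 ≠ v) (hnadj : ¬ K.Adj v d0) :
    ∃ z ∈ A, z ≠ v ∧ ¬ K.Adj v z ∧ SimpIn K A z := by
  classical
  let R : V → Prop := fun u => u ∈ A ∧ u ≠ v ∧ ¬ K.Adj v u
  let D : Finset V := A.filter (fun u => R u ∧ (resG K R).Reachable d0 u)
  let T : Finset V := A.filter (fun u => K.Adj v u ∧ ∃ y ∈ D, K.Adj u y)
  have hD : ∀ u, u ∈ D ↔ R u ∧ (resG K R).Reachable d0 u := by
    intro u; simp only [D, Finset.mem_filter]
    exact ⟨fun h => h.2, fun h => ⟨h.1.1, h⟩⟩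
  have hT : ∀ u, u ∈ T ↔ u ∈ A ∧ K.Adj v u ∧ ∃ y ∈ D, K.Adj u y := by
    intro u; simp only [T, Finset.mem_filter]
  have hR0 : R d0 := ⟨hd0, hne, hnadj⟩
  have hd0D : d0 ∈ D := (hD _).2 ⟨hR0, SimpleGraph.Reachable.refl _⟩
  have hclosed : ∀ z ∈ D, ∀ u ∈ A, K.Adj z u → u ∈ D ∪ T := by
    intro z hz u hu hzu
    rw [Finset.mem_union]
    have hz' := (hD z).1 hz
    by_cases hvu : K.Adj v u
    · exact Or.inr ((hT u).2 ⟨hu, hvu, z, hz, hzu.symm⟩)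
    · left
      have hRu : R u := by
        refine ⟨hu, ?_, hvu⟩
        rintro rfl
        exact hz'.1.2.2 hzu.symm
      refine (hD u).2 ⟨hRu, hz'.2.trans ?_⟩
      exact SimpleGraph.Adj.reachable (G := resG K R) ⟨hzu, hz'.1, hRu⟩
  have hTcl : ∀ a ∈ T, ∀ b ∈ T, a ≠ b → K.Adj a b := by
    intro a ha b hb hab
    obtain ⟨_, hva, y, hy, hay⟩ := (hT a).1 ha
    obtain ⟨_, hvb, y', hy', hby⟩ := (hT b).1 hb
    refine chordal_sep hK (R := R) (v := v) (fun u hu => hu.2) hva hvb hab ?_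
    have hle : resG K R ≤ resG K (fun u => R u ∨ u = a ∨ u = b) :=
      fun u w h => ⟨h.1, Or.inl h.2.1, Or.inl h.2.2⟩
    have r1 : (resG K (fun u => R u ∨ u = a ∨ u = b)).Reachable a y :=
      SimpleGraph.Adj.reachable ⟨hay, by simp, Or.inl ((hD y).1 hy).1⟩
    have r2 : (resG K (fun u => R u ∨ u = a ∨ u = b)).Reachable b y' :=
      SimpleGraph.Adj.reachable ⟨hby, by simp, Or.inl ((hD y').1 hy').1⟩
    exact (r1.trans (((hD y).1 hy).2.mono hle).symm).trans
      ((((hD y').1 hy').2.mono hle).trans r2.symm)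
  have hsub : D ∪ T ⊂ A := by
    rw [Finset.ssubset_iff_of_subset]
    · refine ⟨v, hv, ?_⟩
      rw [Finset.mem_union, hD, hT]
      rintro (h | h)
      · exact h.1.2.1 rfl
      · exact K.irrefl h.2.1
    · intro u hu
      rw [Finset.mem_union, hD, hT] at hu
      rcases hu with h | h
      · exact h.1.1
      · exact h.1
  have hTsub : T ⊂ D ∪ T := by
    rw [Finset.ssubset_iff_of_subset Finset.subset_union_right]
    refine ⟨d0, Finset.mem_union_left _ hd0D, ?_⟩
    rw [hT]; exact fun h => hnadj h.2.1
  obtain ⟨z, hz, hzT, hzs⟩ := ih _ hsub T hTsub hTcl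
  have hzD : z ∈ D := (Finset.mem_union.1 hz).resolve_right hzT
  refine ⟨z, hsub.1 hz, ((hD z).1 hzD).1.2.1, ((hD z).1 hzD).1.2.2, ?_⟩
  intro u hu w hw hzu hzw
  exact hzs u (hclosed z hzD u hu hzu) w (hclosed z hzD w hw hzw) hzu hzw

theorem chordal_dirac {K : SimpleGraph V} (hK : IsChordal K) (A : Finset V) :
    ∀ Q ⊂ A, (∀ u ∈ Q, ∀ w ∈ Q, u ≠ w → K.Adj u w) → ∃ z ∈ A, z ∉ Q ∧ SimpIn K A z := by
  classical
  induction A using Finset.strongInduction with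
  | H A ih =>
    have nonempty_case : ∀ Q ⊂ A, Q.Nonempty → (∀ u ∈ Q, ∀ w ∈ Q, u ≠ w → K.Adj u w) →
        ∃ z ∈ A, z ∉ Q ∧ SimpIn K A z := by
      intro Q hQA hQ hcl
      by_cases huniv : ∀ v ∈ Q, ∀ u ∈ A, u ≠ v → K.Adj v u
      · have h1 : A \ Q ⊂ A := Finset.sdiff_ssubset hQA.1 hQ
        have h2 : (∅ : Finset V) ⊂ A \ Q := by
          rw [Finset.empty_ssubset]
          exact Finset.sdiff_nonempty.2 hQA.2
        obtain ⟨z, hz, -, hzs⟩ := ih _ h1 ∅ h2 (by simp)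
        rw [Finset.mem_sdiff] at hz
        refine ⟨z, hz.1, hz.2, ?_⟩
        intro u hu w hw hzu hzw huw
        by_cases huQ : u ∈ Q
        · exact huniv u huQ w hw huw.symm
        by_cases hwQ : w ∈ Q
        · exact (huniv w hwQ u hu huw).symm
        exact hzs u (Finset.mem_sdiff.2 ⟨hu, huQ⟩) w (Finset.mem_sdiff.2 ⟨hw, hwQ⟩) hzu hzw huw
      · push Not at huniv
        obtain ⟨v, hv, d0, hd0, hne, hnadj⟩ := huniv
        obtain ⟨z, hz, hzv, hzn, hzs⟩ := chordal_step hK ih (hQA.1 hv) hd0 hne hnadj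
        exact ⟨z, hz, fun hh => hzn (hcl v hv z hh hzv.symm), hzs⟩
    intro Q hQA hcl
    by_cases hQ : Q.Nonempty
    · exact nonempty_case Q hQA hQ hcl
    · rw [Finset.not_nonempty_iff_eq_empty] at hQ
      subst hQ
      obtain ⟨v, hv⟩ := Finset.empty_ssubset.1 hQA
      by_cases hA : A = {v}
      · refine ⟨v, hv, by simp, ?_⟩
        intro u hu w hw hvu
        rw [hA, Finset.mem_singleton] at hu
        rw [hu] at hvu
        exact absurd hvu K.irrefl
      · obtain ⟨z, hz, _, hzs⟩ := nonempty_case {v}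
          (Finset.ssubset_iff_subset_ne.2 ⟨Finset.singleton_subset_iff.2 hv, fun h => hA h.symm⟩)
          ⟨v, by simp⟩ (by
            intro u hu w hw huw
            rw [Finset.mem_singleton] at hu hw
            exact absurd (hu.trans hw.symm) huw)
        exact ⟨z, hz, by simp, hzs⟩

theorem chordal_simp_edge {K : SimpleGraph V} (hK : IsChordal K) (A : Finset V) {u w : V}
    (hu : u ∈ A) (hw : w ∈ A) (huw : K.Adj u w) :
    ∃ z ∈ A, (∃ y ∈ A, K.Adj z y) ∧ SimpIn K A z := by
  classical
  let A0 := A.filter (fun z => ∃ y ∈ A, K.Adj z y)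
  have h0 : ∀ z, z ∈ A0 ↔ z ∈ A ∧ ∃ y ∈ A, K.Adj z y := by
    intro z; simp only [A0, Finset.mem_filter]
  obtain ⟨z, hz, -, hzs⟩ := chordal_dirac hK A0 ∅
    (Finset.empty_ssubset.2 ⟨u, (h0 u).2 ⟨hu, w, hw, huw⟩⟩) (by simp)
  rw [h0] at hz
  refine ⟨z, hz.1, hz.2, ?_⟩
  intro a ha b hb hza hzb
  exact hzs a ((h0 a).2 ⟨ha, z, hz.1, hza.symm⟩) b ((h0 b).2 ⟨hb, z, hz.1, hzb.symm⟩) hza hzb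

theorem good_shRank {H : SimpleGraph V} (A : Finset V)
    (h : ∀ A' ⊆ A, (∃ u ∈ A', ∃ w ∈ A', H.Adj u w) →
      ∃ z ∈ A', (∃ y ∈ A', H.Adj z y) ∧ SimpIn H A' z) : ShRank H A := by
  induction A using Finset.strongInduction with
  | H A ih =>
    by_cases hE : ∃ u ∈ A, ∃ w ∈ A, H.Adj u w
    · obtain ⟨z, hz, ⟨y, hy, hzy⟩, hs⟩ := h A subset_rfl hE
      have h1 : A.erase y ⊂ A := Finset.erase_ssubset hy
      have h2 : delClosedNbhd H A y ⊂ A := by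
        rw [Finset.ssubset_iff_of_subset (fun u hu => (mem_delClosedNbhd.1 hu).1)]
        exact ⟨y, hy, fun hh => (mem_delClosedNbhd.1 hh).2.1 rfl⟩
      refine ShRank.shed_simplicial hy hz hzy.symm ?_
        (ih _ h2 fun A' hA' => h A' (hA'.trans h2.1)) (ih _ h1 fun A' hA' => h A' (hA'.trans h1.1))
      intro u hu hzu
      by_cases huy : u = y
      · exact Or.inl huy
      · exact Or.inr (hs y hy u hu hzy hzu (Ne.symm huy))
    · push Not at hE
      exact ShRank.edgeless hE

/-- Deleting a vertex from a cycle leaves a path, all of whose subgraphs have simplicial ends. -/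
theorem cyc_simp_edge {K : SimpleGraph V} {B : Finset V} {m : ℕ} {d : ℕ → V}
    (h : CycLab K B m d) {A : Finset V} (hA : A ⊆ B) (h0 : d 0 ∉ A) {u w : V}
    (hu : u ∈ A) (hw : w ∈ A) (huw : K.Adj u w) :
    ∃ z ∈ A, (∃ y ∈ A, K.Adj z y) ∧ SimpIn K A z := by
  classical
  have hex : ∃ i, i + 1 < m ∧ d i ∈ A ∧ d (i + 1) ∈ A := by
    obtain ⟨i, hi, rfl⟩ := (h.1 u).1 (hA hu)
    obtain ⟨j, hj, rfl⟩ := (h.1 w).1 (hA hw)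
    have hi0 : i ≠ 0 := by rintro rfl; exact h0 hu
    have hj0 : j ≠ 0 := by rintro rfl; exact h0 hw
    rw [h.2.2 i hi j hj] at huw
    have : j = i + 1 ∨ i = j + 1 := by omega
    rcases this with rfl | rfl
    · exact ⟨i, hj, hu, hw⟩
    · exact ⟨j, hi, hw, hu⟩
  obtain ⟨hi, hiA, hiA'⟩ := Nat.find_spec hex
  have hmin : ∀ j, j < Nat.find hex → ¬ _ := fun j hj => Nat.find_min hex hj
  generalize Nat.find hex = i at *
  have huniq : ∀ a ∈ A, K.Adj (d i) a → a = d (i + 1) := by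
    intro a ha hia
    obtain ⟨j, hj, rfl⟩ := (h.1 a).1 (hA ha)
    have hi0 : i ≠ 0 := by rintro rfl; exact h0 hiA
    have hj0 : j ≠ 0 := by rintro rfl; exact h0 ha
    rw [h.2.2 i (by omega) j hj] at hia
    have : j = i + 1 ∨ i = j + 1 := by omega
    rcases this with rfl | rfl
    · rfl
    · exact absurd ⟨by omega, ha, hiA⟩ (hmin j (by omega))
  refine ⟨d i, hiA, ⟨d (i + 1), hiA', ?_⟩, ?_⟩
  · rw [h.2.2 i (by omega) (i + 1) hi]; omega
  · intro a ha b hb hia hib hab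
    exact absurd ((huniq a ha hia).trans (huniq b hb hib).symm) hab

/-- the attachment graph `G(C_1, …, C_t, G_{t+1}, …, G_n)` is shellable iff
every cycle has length 3 or 5. -/
theorem stmt_17 {V : Type*} [DecidableEq V] (n t : ℕ) (ht : t ≤ n) (x : Fin n → V)
    (B : Fin n → Finset V) (G : SimpleGraph V) (Gs : Fin n → SimpleGraph V)
    (ℓ : Fin n → ℕ)
    (hxinj : Function.Injective x)
    (hGsupp : ∀ u v, G.Adj u v → (∃ i, u = x i) ∧ (∃ j, v = x j))
    -- `G` has no isolated vertex
    (hnoiso : ∀ i, ∃ u, G.Adj (x i) u)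
    (hxB : ∀ i, x i ∈ B i)
    (hBdisj : ∀ i j, i ≠ j → Disjoint (B i) (B j))
    -- for `i < t`, `Gs i` is a cycle graph of length `ℓ i ≥ 3` on the vertex set `B i`
    (hcyc : ∀ i : Fin n, (i : ℕ) < t → 3 ≤ ℓ i ∧ IsCycleGraphOn (Gs i) (B i) (ℓ i))
    -- for `i ≥ t`, `Gs i` is a connected chordal graph with at least two vertices,
    -- attached to `G` at a neighbor `x i` of a simplicial vertex `z` of `Gs i`
    (hBcard : ∀ i : Fin n, t ≤ (i : ℕ) → 2 ≤ (B i).card)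
    (hGssupp : ∀ i : Fin n, t ≤ (i : ℕ) → ∀ u v, (Gs i).Adj u v → u ∈ B i ∧ v ∈ B i)
    (hconn : ∀ i : Fin n, t ≤ (i : ℕ) → ((Gs i).induce ((B i : Set V))).Connected)
    (hchordal : ∀ i : Fin n, t ≤ (i : ℕ) → IsChordal (Gs i))
    (hsimp : ∀ i : Fin n, t ≤ (i : ℕ) → ∃ z ∈ B i,
      (∀ u v, (Gs i).Adj z u → (Gs i).Adj z v → u ≠ v → (Gs i).Adj u v) ∧
      (Gs i).Adj z (x i)) :
    ShellableOn (G ⊔ ⨆ i, Gs i) (Finset.univ.biUnion B) ↔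
      ∀ i : Fin n, (i : ℕ) < t → ℓ i = 3 ∨ ℓ i = 5 := by
  classical
  set H := G ⊔ ⨆ i, Gs i with hH
  have hadj : ∀ u v, H.Adj u v ↔ G.Adj u v ∨ ∃ i, (Gs i).Adj u v := by
    intro u v
    rw [hH, SimpleGraph.sup_adj, SimpleGraph.iSup_adj]
  have supp : ∀ i u v, (Gs i).Adj u v → u ∈ B i ∧ v ∈ B i := by
    intro i u v h
    by_cases hi : (i : ℕ) < t
    · exact (hcyc i hi).2.1 u v h
    · exact hGssupp i (by omega) u v h
  have uniq : ∀ i j u, u ∈ B i → u ∈ B j → i = j := by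
    intro i j u hi hj
    by_contra hne
    exact Finset.disjoint_left.1 (hBdisj i j hne) hi hj
  have nonx : ∀ i u v, u ∈ B i → u ≠ x i → H.Adj u v → (Gs i).Adj u v := by
    intro i u v hu hne h
    rcases (hadj u v).1 h with h | ⟨j, h⟩
    · obtain ⟨⟨j, rfl⟩, -⟩ := hGsupp u v h
      exact absurd (by rw [uniq _ _ _ hu (hxB j)]) hne
    · rw [uniq i j u hu (supp j u v h).1]; exact h
  have adjB : ∀ i u v, u ∈ B i → v ∈ B i → (H.Adj u v ↔ (Gs i).Adj u v) := by
    intro i u v hu hv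
    refine ⟨fun h => ?_, fun h => (hadj u v).2 (Or.inr ⟨i, h⟩)⟩
    by_cases hux : u = x i
    · have hvx : v ≠ x i := by
        rintro rfl
        exact h.ne hux
      exact (nonx i v u hv hvx h.symm).symm
    · exact nonx i u v hu hux h
  have hmem : ∀ y, y ∈ Finset.univ.biUnion B ↔ ∃ i, y ∈ B i := by
    intro y; simp
  have hlab : ∀ i : Fin n, (i : ℕ) < t → ∃ d, CycLab (Gs i) (B i) (ℓ i) d ∧ d 0 = x i :=
    fun i hi => exists_cycLab (hcyc i hi).1 (hcyc i hi).2 (hxB i)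
  constructor
  · intro hS i hi
    have hS := hS.shRank
    -- choose a neighbour of each `x j`
    have hz : ∀ j, ∃ z, (Gs j).Adj (x j) z := by
      intro j
      by_cases hj : (j : ℕ) < t
      · obtain ⟨d, hd, hd0⟩ := hlab j hj
        have := (hcyc j hj).1
        refine ⟨d 1, ?_⟩
        rw [← hd0, hd.2.2 0 (by omega) 1 (by omega)]
        omega
      · obtain ⟨z, -, -, h⟩ := hsimp j (by omega)
        exact ⟨z, h.symm⟩
    choose z hz using hz
    have hzx : ∀ j, z j ≠ x j := fun j => (hz j).ne'
    have hzB : ∀ j, z j ∈ B j := fun j => (supp j _ _ (hz j)).2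
    let A' := (Finset.univ.biUnion B) \ B i
    let S0 : Finset V := (Finset.univ.filter (fun j => j ≠ i)).image z
    have hS0mem : ∀ y, y ∈ S0 ↔ ∃ j, j ≠ i ∧ z j = y := by
      intro y; simp [S0]
    have hS0 : IsIndepIn H A' S0 := by
      refine ⟨?_, ?_⟩
      · intro y hy
        obtain ⟨j, hj, rfl⟩ := (hS0mem y).1 hy
        rw [Finset.mem_sdiff, hmem]
        exact ⟨⟨j, hzB j⟩, fun h => hj (uniq _ _ _ (hzB j) h)⟩
      · intro u hu v hv huv
        obtain ⟨j, hj, rfl⟩ := (hS0mem u).1 hu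
        obtain ⟨k, hk, rfl⟩ := (hS0mem v).1 hv
        have h1 := supp j _ _ (nonx j _ _ (hzB j) (hzx j) huv)
        have := uniq _ _ _ h1.2 (hzB k)
        subst this
        exact H.irrefl huv
    obtain ⟨S, hSmax, hS0S⟩ := hS0.exists_max
    have hxS : ∀ j, x j ∉ S := by
      intro j hj
      have hji : j ≠ i := by
        rintro rfl
        exact (Finset.mem_sdiff.1 (hSmax.1.1 hj)).2 (hxB _)
      exact hSmax.1.2 _ hj _ (hS0S ((hS0mem _).2 ⟨j, hji, rfl⟩)) ((hadj _ _).2 (Or.inr ⟨j, hz j⟩))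
    have hBi : ShRank H (B i) := by
      refine hS.link_set S (hSmax.1.subset subset_rfl (hSmax.1.1.trans Finset.sdiff_subset)) _ ?_
      intro y
      constructor
      · intro hy
        refine ⟨(hmem y).2 ⟨i, hy⟩, fun s hs => ?_⟩
        have hs' := Finset.mem_sdiff.1 (hSmax.1.1 hs)
        refine ⟨?_, fun hsy => ?_⟩
        · rintro rfl; exact hs'.2 hy
        · obtain ⟨j, hj⟩ := (hmem s).1 hs'.1
          have h1 := supp j _ _ (nonx j s y hj (by rintro rfl; exact hxS j hs) hsy)
          have := uniq _ _ _ h1.2 hy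
          subst this
          exact hs'.2 hj
      · rintro ⟨hyA, hyS⟩
        by_contra hyB
        have h1 : IsIndepIn H A' (insert y S) :=
          indep_insert (Finset.mem_sdiff.2 ⟨hyA, hyB⟩) hSmax.1 (fun s hs h => (hyS s hs).2 h.symm)
        have h2 := hSmax.2 _ h1 (Finset.subset_insert _ _)
        have h3 : y ∈ S := by rw [h2]; exact Finset.mem_insert_self _ _
        exact (hyS y h3).1 rfl
    obtain ⟨d, hd, -⟩ := hlab i hi
    have hdH : CycLab H (B i) (ℓ i) d := by
      refine ⟨hd.1, hd.2.1, fun a ha b hb => ?_⟩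
      rw [adjB i _ _ ((hd.1 _).2 ⟨a, ha, rfl⟩) ((hd.1 _).2 ⟨b, hb, rfl⟩)]
      exact hd.2.2 a ha b hb
    exact cyc_shRank_length (hcyc i hi).1 hdH hBi
  · intro hℓ
    apply ShRank.shellableOn
    -- simplicial vertices inside the blocks
    have hblock : ∀ i, ∀ A ⊆ B i, x i ∉ A → ∀ u ∈ A, ∀ w ∈ A, (Gs i).Adj u w →
        ∃ z ∈ A, (∃ y ∈ A, (Gs i).Adj z y) ∧ SimpIn (Gs i) A z := by
      intro i A hA hxA u hu w hw huw
      by_cases hi : (i : ℕ) < t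
      · obtain ⟨d, hd, hd0⟩ := hlab i hi
        exact cyc_simp_edge hd hA (by rw [hd0]; exact hxA) hu hw huw
      · exact chordal_simp_edge (hchordal i (by omega)) A hu hw huw
    have main : ∀ A : Finset V, A ⊆ Finset.univ.biUnion B → (∀ j, x j ∈ A → B j ⊆ A) →
        ShRank H A := by
      intro A
      induction A using Finset.strongInduction with
      | H A ih =>
        intro hA hinv
        by_cases hex : ∃ i, x i ∈ A
        · obtain ⟨i, hi⟩ := hex
          have h1 : A.erase (x i) ⊂ A := Finset.erase_ssubset hi
          have h2 : delClosedNbhd H A (x i) ⊂ A := by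
            rw [Finset.ssubset_iff_of_subset (fun u hu => (mem_delClosedNbhd.1 hu).1)]
            exact ⟨x i, hi, fun hh => (mem_delClosedNbhd.1 hh).2.1 rfl⟩
          have hdel : ShRank H (A.erase (x i)) := by
            refine ih _ h1 (h1.1.trans hA) fun j hj y hy => ?_
            rw [Finset.mem_erase] at hj ⊢
            refine ⟨?_, hinv j hj.2 hy⟩
            rintro rfl
            exact hj.1 (by rw [uniq _ _ _ hy (hxB i)])
          have hlink : ShRank H (delClosedNbhd H A (x i)) := by
            refine ih _ h2 (h2.1.trans hA) fun j hj y hy => ?_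
            rw [mem_delClosedNbhd] at hj ⊢
            refine ⟨hinv j hj.1 hy, ?_, ?_⟩
            · rintro rfl
              exact hj.2.1 (by rw [uniq _ _ _ hy (hxB i)])
            · intro hxy
              have hyx : y ≠ x j := by
                rintro rfl; exact hj.2.2 hxy
              have h3 := supp j _ _ (nonx j y _ hy hyx hxy.symm)
              exact hj.2.1 (by rw [uniq _ _ _ h3.2 (hxB i)])
          have hBA := hinv i hi
          by_cases hit : (i : ℕ) < t
          · obtain ⟨d, hd, hd0⟩ := hlab i hit
            obtain ⟨hd1, hd2, hd3⟩ := hd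
            rcases hℓ i hit with hl | hl
            · rw [hl] at hd1 hd2 hd3
              have hB1 : d 1 ∈ B i := (hd1 _).2 ⟨1, by omega, rfl⟩
              have hne : d 1 ≠ x i := by
                rw [← hd0]; intro h
                have := hd2 1 (by omega) 0 (by omega) h
                omega
              refine ShRank.shed_simplicial hi (hBA hB1) ?_ ?_ hlink hdel
              · rw [adjB i _ _ (hxB i) hB1, ← hd0, hd3 0 (by omega) 1 (by omega)]
                omega
              · intro u hu h
                have h3 := nonx i _ _ hB1 hne h
                have h4 := (supp i _ _ h3).2
                rw [adjB i _ _ (hxB i) h4, ← hd0]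
                obtain ⟨j, hj, rfl⟩ := (hd1 u).1 h4
                by_cases hj0 : j = 0
                · left; rw [hj0]
                · right
                  rw [hd3 0 (by omega) j hj]
                  omega
            · rw [hl] at hd1 hd2 hd3
              have hB : ∀ j < 5, d j ∈ B i := fun j hj => (hd1 _).2 ⟨j, hj, rfl⟩
              have hne : ∀ j < 5, j ≠ 0 → d j ≠ x i := by
                intro j hj hj0
                rw [← hd0]; intro h
                exact hj0 (hd2 j hj 0 (by omega) h)
              refine ShRank.shed hi hlink hdel fun S hS => ?_
              have hSA : IsIndepIn H (A.erase (x i)) S := hS.subset subset_rfl fun s hs => by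
                have := mem_delClosedNbhd.1 (hS.1 hs)
                exact Finset.mem_erase.2 ⟨this.2.1, this.1⟩
              have h0S : d 0 ∉ S := by
                rw [hd0]; exact fun h => (Finset.mem_erase.1 (hSA.1 h)).1 rfl
              -- a neighbour `d j` of `x i` whose other neighbour is missing from `S` works
              have fin : ∀ j < 5, (j = 1 ∨ j = 4) →
                  (∀ l < 5, (j = 1 → l = 2) → (j = 4 → l = 3) → d l ∉ S) →
                  ∃ y ∈ A, H.Adj (x i) y ∧ IsIndepIn H (A.erase (x i)) (insert y S) := by
                intro j hj hj' hno
                refine ⟨d j, hBA (hB j hj), ?_, ?_⟩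
                · rw [adjB i _ _ (hxB i) (hB j hj), ← hd0, hd3 0 (by omega) j hj]
                  omega
                · refine indep_insert (Finset.mem_erase.2 ⟨hne j hj (by omega), hBA (hB j hj)⟩)
                    hSA fun s hs hjs => ?_
                  have h3 := nonx i _ _ (hB j hj) (hne j hj (by omega)) hjs
                  obtain ⟨l, hl', rfl⟩ := (hd1 s).1 (supp i _ _ h3).2
                  rw [hd3 j hj l hl'] at h3
                  by_cases hl0 : l = 0
                  · rw [hl0] at hs; exact h0S hs
                  · exact hno l hl' (by omega) (by omega) hs
              by_cases h2S : d 2 ∈ S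
              · refine fin 4 (by omega) (by omega) fun l hl' _ hl3 h3S => ?_
                have : l = 3 := hl3 rfl
                subst this
                refine hS.2 _ h2S _ h3S ?_
                rw [adjB i _ _ (hB 2 (by omega)) (hB 3 (by omega)), hd3 2 (by omega) 3 (by omega)]
                omega
              · refine fin 1 (by omega) (by omega) fun l hl' hl2 _ => ?_
                rw [hl2 rfl]; exact h2S
          · obtain ⟨z, hzB, hzs, hzx⟩ := hsimp i (by omega)
            refine ShRank.shed_simplicial hi (hBA hzB) ((adjB i _ _ (hxB i) hzB).2 hzx.symm) ?_
              hlink hdel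
            intro u hu h
            have h3 := nonx i _ _ hzB hzx.ne h
            have h4 := (supp i _ _ h3).2
            by_cases hux : u = x i
            · exact Or.inl hux
            · right
              rw [adjB i _ _ (hxB i) h4]
              exact hzs _ _ hzx h3 (Ne.symm hux)
        · push Not at hex
          refine good_shRank A fun A' hA' hE => ?_
          obtain ⟨u, hu, w, hw, huw⟩ := hE
          obtain ⟨i, hui⟩ := (hmem u).1 (hA (hA' hu))
          have nox : ∀ v ∈ A', v ≠ x i := by
            rintro v hv rfl; exact hex i (hA' hv)
          have huw' := nonx i u w hui (nox u hu) huw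
          obtain ⟨z, hz, ⟨y, hy, hzy⟩, hzs⟩ := hblock i (A' ∩ B i) Finset.inter_subset_right
            (fun h => nox _ (Finset.mem_inter.1 h).1 rfl) u (Finset.mem_inter.2 ⟨hu, hui⟩) w
            (Finset.mem_inter.2 ⟨hw, (supp i _ _ huw').2⟩) huw'
          rw [Finset.mem_inter] at hz hy
          refine ⟨z, hz.1, ⟨y, hy.1, (adjB i _ _ hz.2 hy.2).2 hzy⟩, ?_⟩
          intro a ha b hb hza hzb hab
          have ha' := nonx i _ _ hz.2 (nox z hz.1) hza
          have hb' := nonx i _ _ hz.2 (nox z hz.1) hzb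
          have haB := (supp i _ _ ha').2
          have hbB := (supp i _ _ hb').2
          exact (adjB i _ _ haB hbB).2 (hzs a (Finset.mem_inter.2 ⟨ha, haB⟩) b
            (Finset.mem_inter.2 ⟨hb, hbB⟩) ha' hb' hab)
    exact main _ subset_rfl fun j _ y hy => (hmem y).2 ⟨j, hy⟩
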